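/- arXiv:1102.3618 — 2 statements merged into one kernel-verified Lean document; each statement's English description precedes it below -/
import Mathlib

section
/- Let ψ be the trilinear form on 𝔰𝔩₃(ℂ) given by ψ(a,b,c) = tr((ab−ba)c). The subspace of all ℂ-linear endomorphisms X of 𝔰𝔩₃(ℂ) satisfying ψ(Xa,b,c) + ψ(a,Xb,c) + ψ(a,b,Xc) = 0 for all a,b,c ∈ 𝔰𝔩₃(ℂ) (the infinitesimal stabilizer of ψ) is exactly the set of adjoint operators {ad_m : x ↦ mx − xm | m ∈ 𝔰𝔩₃(ℂ)}, and it has complex dimension 8. -/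
open Matrix

/-- The trilinear form `ψ(a,b,c) = tr((ab − ba)c)` on 3×3 complex matrices. -/
noncomputable def psi (a b c : Matrix (Fin 3) (Fin 3) ℂ) : ℂ :=
  ((a * b - b * a) * c).trace

/-- `𝔰𝔩₃(ℂ)`: the traceless 3×3 complex matrices. -/
noncomputable def sl3 : Submodule ℂ (Matrix (Fin 3) (Fin 3) ℂ) :=
  LinearMap.ker (Matrix.traceLinearMap (Fin 3) ℂ ℂ)

lemma psi_add₁ (u v b c : Matrix (Fin 3) (Fin 3) ℂ) :
    psi (u + v) b c = psi u b c + psi v b c := by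
  simp only [psi]
  rw [show ((u + v) * b - b * (u + v)) * c
      = (u * b - b * u) * c + (v * b - b * v) * c by noncomm_ring, trace_add]

lemma psi_add₂ (a u v c : Matrix (Fin 3) (Fin 3) ℂ) :
    psi a (u + v) c = psi a u c + psi a v c := by
  simp only [psi]
  rw [show (a * (u + v) - (u + v) * a) * c
      = (a * u - u * a) * c + (a * v - v * a) * c by noncomm_ring, trace_add]

lemma psi_add₃ (a b u v : Matrix (Fin 3) (Fin 3) ℂ) :
    psi a b (u + v) = psi a b u + psi a b v := by
  simp only [psi]
  rw [show (a * b - b * a) * (u + v)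
      = (a * b - b * a) * u + (a * b - b * a) * v by noncomm_ring, trace_add]

lemma psi_smul₁ (s : ℂ) (u b c : Matrix (Fin 3) (Fin 3) ℂ) :
    psi (s • u) b c = s * psi u b c := by
  simp only [psi]
  rw [smul_mul_assoc, mul_smul_comm, ← smul_sub, smul_mul_assoc, trace_smul, smul_eq_mul]

lemma psi_smul₂ (s : ℂ) (a u c : Matrix (Fin 3) (Fin 3) ℂ) :
    psi a (s • u) c = s * psi a u c := by
  simp only [psi]
  rw [mul_smul_comm, smul_mul_assoc, ← smul_sub, smul_mul_assoc, trace_smul, smul_eq_mul]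

lemma psi_smul₃ (s : ℂ) (a b u : Matrix (Fin 3) (Fin 3) ℂ) :
    psi a b (s • u) = s * psi a b u := by
  simp only [psi]
  rw [mul_smul_comm, trace_smul, smul_eq_mul]

/-- The infinitesimal stabilizer of ψ inside `End(𝔰𝔩₃(ℂ))`, as a subspace. -/
noncomputable def psiStabilizer : Submodule ℂ (Module.End ℂ ↥sl3) where
  carrier := {X | ∀ a b c : ↥sl3,
    psi ↑(X a) ↑b ↑c + psi ↑a ↑(X b) ↑c + psi ↑a ↑b ↑(X c) = 0}
  add_mem' := by
    intro X Y hX hY a b c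
    have h1 := hX a b c
    have h2 := hY a b c
    simp only [LinearMap.add_apply, Submodule.coe_add, psi_add₁, psi_add₂, psi_add₃]
    linear_combination h1 + h2
  zero_mem' := by
    intro a b c
    simp [psi]
  smul_mem' := by
    intro s X hX a b c
    have h := hX a b c
    simp only [LinearMap.smul_apply, SetLike.val_smul, psi_smul₁, psi_smul₂, psi_smul₃]
    linear_combination s * h

/-- A tensor satisfying the matrix-unit form of `ψ`-invariance, and vanishing on the identity
in its source and target traces, is given by a commutator. -/
lemma exists_commutator_of_tensor (y : Fin 3 → Fin 3 → Fin 3 → Fin 3 → ℂ)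
    (h : ∀ i j k l p q,
      ((if l = p then y i j q k else 0) - if q = k then y i j l p else 0)
      + ((if q = i then y k l j p else 0) - if j = p then y k l q i else 0)
      + ((if j = k then y p q l i else 0) - if l = i then y p q j k else 0) = 0)
    (htrace : ∀ i j, ∑ q, y i j q q = 0) (hone : ∀ q k, ∑ i, y i i q k = 0) :
    ∃ m : Matrix (Fin 3) (Fin 3) ℂ, ∀ i j q k,
      y i j q k = (if j = k then m q i else 0) - if q = i then m j k else 0 := by
  set S : Fin 3 → Fin 3 → ℂ := fun k j => ∑ p, y k p j p
  set T : Fin 3 → Fin 3 → ℂ := fun q i => ∑ p, y p q p i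
  have contracted : ∀ i j q k, 3 * y i j q k - y k j q i - y i q j k
      + (if q = i then S k j else 0) + (if j = k then T q i else 0) = 0 := by
    intro i j q k
    have hsum : ∑ p, (((if p = p then y i j q k else 0) - if q = k then y i j p p else 0)
      + ((if q = i then y k p j p else 0) - if j = p then y k p q i else 0)
      + ((if j = k then y p q p i else 0) - if p = i then y p q j k else 0)) = 0 :=
      Finset.sum_eq_zero fun p _ => h i j k p p q
    have hif (P : Prop) [Decidable P] (g : Fin 3 → ℂ) :
        ∑ p, (if P then g p else 0) = if P then ∑ p, g p else 0 := by
      split_ifs <;> simp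
    simp only [Finset.sum_add_distrib, Finset.sum_sub_distrib, hif, htrace, if_true, ite_self,
      Finset.sum_ite_eq, Finset.sum_ite_eq', Finset.mem_univ, Finset.sum_const,
      Finset.card_univ, Fintype.card_fin, nsmul_eq_mul] at hsum
    push_cast at hsum
    linear_combination hsum
  have solved : ∀ i j q k, y i j q k =
      -((if q = i then 7 / 15 * S k j + 2 / 15 * T j k else 0)
        + (if q = k then (S i j + T j i) / 5 else 0)
        + (if j = i then (S k q + T q k) / 5 else 0)
        + (if j = k then 2 / 15 * S i q + 7 / 15 * T q i else 0)) := by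
    intro i j q k
    have h1 := contracted i j q k
    have h2 := contracted k j q i
    have h3 := contracted i q j k
    have h4 := contracted k q j i
    split_ifs at h1 h2 h3 h4 ⊢ <;>
      linear_combination (7 / 15) * h1 + (1 / 5) * h2 + (1 / 5) * h3 + (2 / 15) * h4
  have antisymm : ∀ q k, T q k = -S k q := by
    have hsum : ∀ q k, 6 * (S k q + T q k)
        + (if q = k then ∑ i, (S i i + T i i) else 0) = 0 := by
      intro q k
      have := hone q k
      simp only [solved] at this
      fin_cases q <;> fin_cases k <;> simp [Fin.sum_univ_three] at this ⊢ <;>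
        first
          | linear_combination -5 * this
          | linear_combination (-5 / 6) * this
    have h0 := hsum 0 0
    have h1 := hsum 1 1
    have h2 := hsum 2 2
    have htr : ∑ i, (S i i + T i i) = 0 := by
      simp only [if_true, Fin.sum_univ_three] at h0 h1 h2 ⊢
      linear_combination (h0 + h1 + h2) / 9
    intro q k
    have := hsum q k
    rw [htr, ite_self] at this
    linear_combination this / 6
  refine ⟨fun q i => S i q / 3, fun i j q k => ?_⟩
  rw [solved]
  simp only [antisymm]
  split_ifs <;> ring

lemma trace_coe_sl3 (a : sl3) : (a : Matrix (Fin 3) (Fin 3) ℂ).trace = 0 := a.2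

/-- The projection of `3 × 3` matrices onto the traceless ones along the scalar matrices. -/
noncomputable def tracelessPart : Matrix (Fin 3) (Fin 3) ℂ →ₗ[ℂ] sl3 :=
  (LinearMap.id - ((3 : ℂ)⁻¹ • (Matrix.traceLinearMap (Fin 3) ℂ ℂ)).smulRight 1).codRestrict sl3
    fun A => by simp [sl3]; ring

lemma coe_tracelessPart (A : Matrix (Fin 3) (Fin 3) ℂ) :
    (tracelessPart A : Matrix (Fin 3) (Fin 3) ℂ) = A - (3⁻¹ * A.trace) • 1 := rfl

lemma tracelessPart_coe (a : sl3) : tracelessPart a = a :=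
  Subtype.ext (by simp [coe_tracelessPart, trace_coe_sl3])

lemma tracelessPart_one : tracelessPart 1 = 0 :=
  Subtype.ext (by simp [coe_tracelessPart])

lemma coe_tracelessPart_mul_sub (A B : Matrix (Fin 3) (Fin 3) ℂ) :
    (tracelessPart A : Matrix (Fin 3) (Fin 3) ℂ) * B - B * tracelessPart A = A * B - B * A := by
  simp [coe_tracelessPart, sub_mul, mul_sub]

lemma psi_cyclic (a b c : Matrix (Fin 3) (Fin 3) ℂ) : psi a b c = psi b c a := by
  simp only [psi, sub_mul, trace_sub]
  rw [Matrix.trace_mul_cycle b c a, Matrix.trace_mul_cycle b a c,]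

lemma psi_tracelessPart₁ (a b c : Matrix (Fin 3) (Fin 3) ℂ) :
    psi (tracelessPart a) b c = psi a b c := by
  simp only [psi, coe_tracelessPart_mul_sub]

lemma psi_tracelessPart₂ (a b c : Matrix (Fin 3) (Fin 3) ℂ) :
    psi a (tracelessPart b) c = psi a b c := by
  rw [psi_cyclic, psi_tracelessPart₁, ← psi_cyclic]

lemma psi_tracelessPart₃ (a b c : Matrix (Fin 3) (Fin 3) ℂ) :
    psi a b (tracelessPart c) = psi a b c := by
  rw [psi_cyclic, psi_tracelessPart₂, ← psi_cyclic]

lemma psi_single_single (M : Matrix (Fin 3) (Fin 3) ℂ) (k l p q : Fin 3) :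
    psi M (single k l 1) (single p q 1)
      = (if l = p then M q k else 0) - if q = k then M l p else 0 := by
  rw [psi, sub_mul, trace_sub, Matrix.mul_assoc, Matrix.trace_mul_cycle, Matrix.trace_mul_comm M]
  by_cases hlp : l = p <;> by_cases hqk : q = k <;>
    simp [hlp, hqk, Matrix.trace_single_mul]

/-- The commutator is an infinitesimal symmetry of `ψ`. -/
lemma psi_commutator (m a b c : Matrix (Fin 3) (Fin 3) ℂ) :
    psi (m * a - a * m) b c + psi a (m * b - b * m) c + psi a b (m * c - c * m) = 0 := by
  simp only [psi, ← trace_add]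
  rw [show ((m * a - a * m) * b - b * (m * a - a * m)) * c
      + (a * (m * b - b * m) - (m * b - b * m) * a) * c + (a * b - b * a) * (m * c - c * m)
      = m * ((a * b - b * a) * c) - (a * b - b * a) * c * m by noncomm_ring,
    trace_sub, trace_mul_comm, sub_self]

/-- An infinitesimal symmetry of `ψ` is a commutator. -/
lemma exists_commutator_of_psi_invariant (X : Module.End ℂ sl3)
    (hX : ∀ a b c : sl3, psi (X a) b c + psi a (X b) c + psi a b (X c) = 0) :
    ∃ m : sl3, ∀ x : sl3, (X x : Matrix (Fin 3) (Fin 3) ℂ) = m * x - x * m := by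
  let f : Matrix (Fin 3) (Fin 3) ℂ →ₗ[ℂ] Matrix (Fin 3) (Fin 3) ℂ :=
    sl3.subtype ∘ₗ X ∘ₗ tracelessPart
  have hf (a b c) : psi (f a) b c + psi a (f b) c + psi a b (f c) = 0 := by
    have := hX (tracelessPart a) (tracelessPart b) (tracelessPart c)
    simp only [psi_tracelessPart₁, psi_tracelessPart₂, psi_tracelessPart₃] at this
    exact this
  obtain ⟨m, hm⟩ := exists_commutator_of_tensor (fun i j q k => f (single i j 1) q k)
    (fun i j k l p q => by
      have := hf (single i j 1) (single k l 1) (single p q 1)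
      rw [psi_cyclic (single i j 1) (f _), ← psi_cyclic (f _) (single i j 1)] at this
      simpa only [psi_single_single] using this)
    (fun i j => trace_coe_sl3 (X (tracelessPart (single i j 1))))
    (fun q k => by
      have hone : ∑ i : Fin 3, single i i (1 : ℂ) = 1 := by
        ext i j
        fin_cases i <;> fin_cases j <;> simp [Fin.sum_univ_three, Matrix.single]
      rw [← Matrix.sum_apply, ← map_sum, hone]
      simp [f, tracelessPart_one])
  have hfm (A) : f A = m * A - A * m := by
    have : f = LinearMap.mulLeft ℂ m - LinearMap.mulRight ℂ m := by
      refine Matrix.ext_linearMap _ fun i j => LinearMap.ext_ring ?_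
      ext q k
      have := hm i j q k
      simp only [LinearMap.comp_apply, Matrix.singleLinearMap_apply, LinearMap.sub_apply,
        LinearMap.mulLeft_apply, LinearMap.mulRight_apply, Matrix.sub_apply, this]
      by_cases hj : j = k <;> by_cases hq : q = i <;>
        simp [hj, hq, Matrix.mul_apply, Matrix.single, eq_comm (a := i) (b := q)]
    rw [this]
    rfl
  refine ⟨tracelessPart m, fun x => ?_⟩
  rw [coe_tracelessPart_mul_sub, ← hfm]
  simp [f, tracelessPart_coe]

/-- The adjoint representation of `𝔰𝔩₃(ℂ)`. -/
noncomputable def adSl3 : sl3 →ₗ[ℂ] Module.End ℂ sl3 :=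
  LinearMap.mk₂ ℂ (fun m x => ⟨m * x - x * m, by
      change Matrix.trace (_ : Matrix (Fin 3) (Fin 3) ℂ) = 0
      rw [trace_sub, trace_mul_comm, sub_self]⟩)
    (fun _ _ _ => Subtype.ext (by simp; noncomm_ring))
    (fun _ _ _ => Subtype.ext (by simp [smul_sub]))
    (fun _ _ _ => Subtype.ext (by simp; noncomm_ring))
    (fun _ _ _ => Subtype.ext (by simp [smul_sub]))

lemma coe_adSl3_apply (m x : sl3) :
    (adSl3 m x : Matrix (Fin 3) (Fin 3) ℂ) = m * x - x * m := rfl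

lemma adSl3_injective : Function.Injective adSl3 := by
  rw [injective_iff_map_eq_zero]
  intro m hm
  have hcomm (A : Matrix (Fin 3) (Fin 3) ℂ) : A * (m : Matrix (Fin 3) (Fin 3) ℂ) = m * A := by
    have h0 := coe_adSl3_apply m (tracelessPart A)
    rw [hm] at h0
    have h1 := coe_tracelessPart_mul_sub A m
    rw [← neg_sub, ← h0] at h1
    exact sub_eq_zero.mp (by simpa using h1.symm)
  obtain ⟨s, hs⟩ := Matrix.mem_range_scalar_of_commute_single
    (M := (m : Matrix (Fin 3) (Fin 3) ℂ)) fun i j _ => hcomm (single i j 1)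
  have htr := trace_coe_sl3 m
  rw [← hs] at htr
  have hs0 : s = 0 := by simpa [Matrix.trace_fin_three] using htr
  exact Subtype.ext (by rw [← hs, hs0]; simp)

lemma finrank_sl3 : Module.finrank ℂ sl3 = 8 := by
  have h := LinearMap.finrank_range_add_finrank_ker (Matrix.traceLinearMap (Fin 3) ℂ ℂ)
  have hsurj : Function.Surjective (Matrix.traceLinearMap (Fin 3) ℂ ℂ) := fun s =>
    ⟨single 0 0 s, by simp⟩
  rw [LinearMap.range_eq_top.mpr hsurj, finrank_top, Module.finrank_matrix] at h
  simp at h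
  change Module.finrank ℂ (LinearMap.ker (Matrix.traceLinearMap (Fin 3) ℂ ℂ)) = 8
  omega

lemma mem_psiStabilizer_iff (X : Module.End ℂ sl3) :
    X ∈ psiStabilizer ↔
      ∃ m : sl3, ∀ x : sl3, (X x : Matrix (Fin 3) (Fin 3) ℂ) = m * x - x * m := by
  refine ⟨exists_commutator_of_psi_invariant X, fun ⟨m, hm⟩ a b c => ?_⟩
  rw [hm, hm, hm]
  exact psi_commutator m a b c

lemma range_adSl3 : LinearMap.range adSl3 = psiStabilizer := by
  ext X
  rw [mem_psiStabilizer_iff, LinearMap.mem_range]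
  refine exists_congr fun m => ⟨?_, fun h => ?_⟩
  · rintro rfl x
    rfl
  · exact LinearMap.ext fun x => Subtype.ext (h x).symm

set_option maxSynthPendingDepth 3 in
set_option synthInstance.maxHeartbeats 1000000 in
/-- The infinitesimal stabilizer of ψ in `End(𝔰𝔩₃(ℂ))` is exactly the set of adjoint
operators `ad_m : x ↦ mx − xm` for `m ∈ 𝔰𝔩₃(ℂ)`, and it has complex dimension 8. -/
theorem psiStabilizer_eq_ad_and_finrank_eq_eight :
    ({X : Module.End ℂ ↥sl3 | ∀ a b c : ↥sl3,
        psi ↑(X a) ↑b ↑c + psi ↑a ↑(X b) ↑c + psi ↑a ↑b ↑(X c) = 0}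
      = {X : Module.End ℂ ↥sl3 | ∃ m : ↥sl3, ∀ x : ↥sl3,
          (↑(X x) : Matrix (Fin 3) (Fin 3) ℂ)
            = (m : Matrix (Fin 3) (Fin 3) ℂ) * (x : Matrix (Fin 3) (Fin 3) ℂ)
              - (x : Matrix (Fin 3) (Fin 3) ℂ) * (m : Matrix (Fin 3) (Fin 3) ℂ)}) ∧
    Module.finrank ℂ ↥psiStabilizer = 8 := by
  refine ⟨Set.ext mem_psiStabilizer_iff, ?_⟩
  rw [← range_adSl3, LinearMap.finrank_range_of_inj adSl3_injective, finrank_sl3]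
end

section
/- Let Q(t) = 27·(t+1)(t+2)⋯(t+7)/7! ∈ ℚ[t]. There is exactly one polynomial P ∈ ℚ[t] satisfying both functional equations P(t) − P(t−3) = 27·(Q(t−2) − Q(t−3)) and P(t) = −P(−t−6), namely P(t) = 3⁵·B₇(t+6) − 3⁴·B₅(t+5) + 3³·B₃(t+4) − 3²·B₁(t+3), where B_b(s) = s(s−1)⋯(s−b+1)/b! denotes the binomial-coefficient polynomial of degree b. Moreover this polynomial satisfies P(0) = 0 and P(−1) = 9. -/
open Polynomial

/-- The binomial-coefficient polynomial `B_b(s) = s(s−1)⋯(s−b+1)/b!` of degree `b`. -/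
noncomputable def binomPoly (b : ℕ) : Polynomial ℚ :=
  C ((b.factorial : ℚ)⁻¹) * ∏ i ∈ Finset.range b, (X - C (i : ℚ))

/-- `Q(t) = 27·(t+1)(t+2)⋯(t+7)/7! = 27·B₇(t+7)`. -/
noncomputable def Qpoly : Polynomial ℚ :=
  C 27 * (binomPoly 7).comp (X + C 7)

/-- `P(t) = 3⁵·B₇(t+6) − 3⁴·B₅(t+5) + 3³·B₃(t+4) − 3²·B₁(t+3)`. -/
noncomputable def Ppoly : Polynomial ℚ :=
  C (3 ^ 5) * (binomPoly 7).comp (X + C 6) - C (3 ^ 4) * (binomPoly 5).comp (X + C 5)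
    + C (3 ^ 3) * (binomPoly 3).comp (X + C 4) - C (3 ^ 2) * (binomPoly 1).comp (X + C 3)

theorem eval_binomPoly (b : ℕ) (s : ℚ) :
    (binomPoly b).eval s = (b.factorial : ℚ)⁻¹ * ∏ i ∈ Finset.range b, (s - i) := by
  simp [binomPoly, eval_prod]

/-- A polynomial over a field of characteristic zero that is invariant under a nonzero
translation and has a root is zero. -/
theorem eq_zero_of_comp_X_sub_C_eq_self {K : Type*} [Field K] [CharZero K] {p : K[X]} {c a : K}
    (hc : c ≠ 0) (hp : p.comp (X - C c) = p) (ha : p.eval a = 0) : p = 0 := by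
  have root (n : ℕ) : p.IsRoot (a - n * c) := by
    induction n with
    | zero => simpa using ha
    | succ n ih =>
      rw [← hp] at ih
      simpa [IsRoot, eval_comp, add_mul, sub_sub] using ih
  have inj : Function.Injective fun n : ℕ => a - n * c := fun m n h => by
    simpa [hc] using h
  exact eq_zero_of_infinite_isRoot p
    ((Set.infinite_range_of_injective inj).mono (Set.range_subset_iff.mpr root))

theorem Ppoly_sub_comp : Ppoly - Ppoly.comp (X - C 3)
    = C 27 * (Qpoly.comp (X - C 2) - Qpoly.comp (X - C 3)) := by
  refine Polynomial.funext fun t => ?_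
  simp only [Ppoly, Qpoly, eval_sub, eval_add, eval_mul, eval_comp, eval_X, eval_C,
    eval_binomPoly, Finset.prod_range_succ, Finset.prod_range_zero, Nat.factorial]
  push_cast
  ring

theorem Ppoly_eq_neg_comp : Ppoly = -(Ppoly.comp (-X - C 6)) := by
  refine Polynomial.funext fun t => ?_
  simp only [Ppoly, eval_sub, eval_add, eval_mul, eval_neg, eval_comp, eval_X, eval_C,
    eval_binomPoly, Finset.prod_range_succ, Finset.prod_range_zero, Nat.factorial]
  push_cast
  ring

/-- `Ppoly` is the unique polynomial `P ∈ ℚ[t]` satisfying both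
`P(t) − P(t−3) = 27·(Q(t−2) − Q(t−3))` and `P(t) = −P(−t−6)`;
moreover `P(0) = 0` and `P(−1) = 9`. -/
theorem unique_hilbert_polynomial :
    (Ppoly - Ppoly.comp (X - C 3)
      = C 27 * (Qpoly.comp (X - C 2) - Qpoly.comp (X - C 3))) ∧
    (Ppoly = -(Ppoly.comp (-X - C 6))) ∧
    (∀ P : Polynomial ℚ,
      (P - P.comp (X - C 3) = C 27 * (Qpoly.comp (X - C 2) - Qpoly.comp (X - C 3))) →
      (P = -(P.comp (-X - C 6))) → P = Ppoly) ∧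
    Ppoly.eval 0 = 0 ∧ Ppoly.eval (-1) = 9 := by
  refine ⟨Ppoly_sub_comp, Ppoly_eq_neg_comp, fun P h₁ h₂ => ?_, ?_, ?_⟩
  · have center {R : ℚ[X]} (h : R = -(R.comp (-X - C 6))) : R.eval (-3) = 0 := by
      have := congrArg (eval (-3)) h
      norm_num [eval_comp] at this
      linarith
    refine sub_eq_zero.mp (eq_zero_of_comp_X_sub_C_eq_self (c := 3) (a := -3) (by norm_num) ?_ ?_)
    · rw [sub_comp]
      linear_combination Ppoly_sub_comp - h₁
    · rw [eval_sub, center h₂, center Ppoly_eq_neg_comp, sub_zero]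
  all_goals
    norm_num [Ppoly, eval_comp, eval_binomPoly, Finset.prod_range_succ, Nat.factorial]
end
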